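/- A collapse-free 2-NW N satisfies the LCPDL sentence grid₁ ∧ grid₂ ∧ grid₃ if and only if there exists N ≥ 1 such that the operation sequence of N is the concatenation, for i = 1, 2, ..., N, of the blocks ↑1 ↑2 (↓1)^i ↓2. -/

import Mathlib

/-- Order-2 stack operations over stack alphabet `S`. -/
inductive Op (S : Type) : Type where
  | push1 : S → Op S
  | pop1  : Op S
  | push2 : Op S
  | pop2  : Op S
  | collapse : Op S
  deriving DecidableEq

/-- Annotated stack symbol: (symbol, collapse link, position annotation). -/
abbrev ASym (S : Type) : Type := S × ℕ × ℤ
/-- Annotated order-1 stack, topmost symbol first. -/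
abbrev Stk1 (S : Type) : Type := List (ASym S)
/-- Annotated order-2 stack: list of (position annotation, order-1 stack), topmost first.
In `[[u_1][u_2] ⋯ [u_n]]` the topmost stack `u_n` comes first in the list. -/
abbrev Stk2 (S : Type) : Type := List (ℤ × Stk1 S)

/-- The initial order-2 stack `[[]]`, its unique (empty) order-1 stack annotated `-1`. -/
def initStk (S : Type) : Stk2 S := [(-1, ([] : Stk1 S))]

/-- One step of the annotated semantics; `p` is the current position.
`push1 s` records the collapse link `n-1` (number of stacks below the top) and the
position annotation `p`; `push2` duplicates the top stack annotating the copy with `p`;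
`collapse` keeps the bottom `i` order-1 stacks, where `i` is the collapse link of the
topmost symbol.  Undefined operations yield `none`. -/
def step {S : Type} (p : ℕ) (op : Op S) (W : Stk2 S) : Option (Stk2 S) :=
  match op, W with
  | .push2, t :: rest => some (((p : ℤ), t.2) :: t :: rest)
  | .pop2, _ :: t :: rest => some (t :: rest)
  | .push1 s, (a, u) :: rest => some ((a, (s, rest.length, (p : ℤ)) :: u) :: rest)
  | .pop1, (a, _ :: u) :: rest => some ((a, u) :: rest)
  | .collapse, (_, (_, i, _) :: _) :: _ =>
      if 1 ≤ i ∧ i < W.length then some (W.drop (W.length - i)) else none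
  | _, _ => none

def runFrom {S : Type} (p : ℕ) (W : Stk2 S) : List (Op S) → Option (Stk2 S)
  | [] => some W
  | op :: rest => (step p op W).bind fun W' => runFrom (p + 1) W' rest

/-- `stkAt ops j` is the annotated order-2 stack `W_j` after executing `op_0 ⋯ op_j`
(for `j = -1` this is the initial stack `[[]]`). -/
def stkAt {S : Type} (ops : List (Op S)) (j : ℤ) : Option (Stk2 S) :=
  runFrom 0 (initStk S) (ops.take (j + 1).toNat)

/-- A nonempty sequence of operations is valid if every operation is defined,
starting from the empty order-2 stack `[[]]`. -/
def Valid {S : Type} (ops : List (Op S)) : Prop :=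
  ops ≠ [] ∧ (runFrom 0 (initStk S) ops).isSome

/-- `push1At ops j` is `push1(j)`: the position annotation of the topmost symbol of the
topmost order-1 stack of `W_j`, or `-1` if that stack is empty (also `-1` for `j = -1`). -/
def push1At {S : Type} (ops : List (Op S)) (j : ℤ) : ℤ :=
  match stkAt ops j with
  | some ((_, (_, _, p) :: _) :: _) => p
  | _ => -1

/-- `Push2At ops j` is `Push2(j)`: the position annotation of the topmost order-1 stack
of `W_j` (`-1` for `j = -1`). -/
def Push2At {S : Type} (ops : List (Op S)) (j : ℤ) : ℤ :=
  match stkAt ops j with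
  | some ((a, _) :: _) => a
  | _ => -1

/-- The order-1 nesting relation `i ↷1 j` of the 2-NW generated by `ops`. -/
def Nest1 {S : Type} (ops : List (Op S)) (i j : ℕ) : Prop :=
  ops[j]? = some Op.pop1 ∧ (i : ℤ) = push1At ops ((j : ℤ) - 1)

/-- The order-2 nesting relation `i ↷2 j` of the 2-NW generated by `ops`:
either `j` is a `↓2` popping the order-1 stack created at `i`, or `j` is a collapse
and `i ≥ 0` is the position annotation of one of the order-1 stacks removed by it
(the removed stacks are the topmost `|W_{j-1}| - |W_j|` ones). -/
def Nest2 {S : Type} (ops : List (Op S)) (i j : ℕ) : Prop :=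
  (ops[j]? = some Op.pop2 ∧ (i : ℤ) = Push2At ops ((j : ℤ) - 1)) ∨
  (ops[j]? = some Op.collapse ∧
    ∃ W W' : Stk2 S, stkAt ops ((j : ℤ) - 1) = some W ∧ stkAt ops (j : ℤ) = some W' ∧
      ∃ d : ℕ, d < W.length - W'.length ∧ ∃ e, W[d]? = some e ∧ e.1 = (i : ℤ))

mutual
/-- Node formulas of LCPDL (with `⊤` as the abbreviation `true`). -/
inductive NF (A : Type) : Type where
  | top : NF A
  | atom : A → NF A
  | or : NF A → NF A → NF A
  | not : NF A → NF A
  | dia : PF A → NF A → NF A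
  | loop : PF A → NF A

/-- Path formulas of LCPDL: tests, `→`, `←`, `↷1`, `↶1`, `↷2`, `↶2`, `·`, `+`, `*`. -/
inductive PF (A : Type) : Type where
  | test : NF A → PF A
  | fwd : PF A
  | bwd : PF A
  | up1 : PF A
  | dn1 : PF A
  | up2 : PF A
  | dn2 : PF A
  | comp : PF A → PF A → PF A
  | union : PF A → PF A → PF A
  | star : PF A → PF A
end

mutual
/-- Satisfaction of a node formula at a position of the 2-NW `⟨lab, Nest1 ops, Nest2 ops⟩`. -/
def nSat {S A : Type} (lab : List A) (ops : List (Op S)) : NF A → ℕ → Prop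
  | .top, i => i < lab.length
  | .atom a, i => lab[i]? = some a
  | .or φ ψ, i => nSat lab ops φ i ∨ nSat lab ops ψ i
  | .not φ, i => i < lab.length ∧ ¬ nSat lab ops φ i
  | .dia π φ, i => ∃ j, pSat lab ops π i j ∧ nSat lab ops φ j
  | .loop π, i => pSat lab ops π i i

/-- Satisfaction of a path formula at a pair of positions. -/
def pSat {S A : Type} (lab : List A) (ops : List (Op S)) : PF A → ℕ → ℕ → Prop
  | .test φ, i, j => i = j ∧ nSat lab ops φ i
  | .fwd, i, j => j = i + 1 ∧ j < lab.length
  | .bwd, i, j => i = j + 1 ∧ i < lab.length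
  | .up1, i, j => Nest1 ops i j
  | .dn1, i, j => Nest1 ops j i
  | .up2, i, j => Nest2 ops i j
  | .dn2, i, j => Nest2 ops j i
  | .comp π ρ, i, j => ∃ m, pSat lab ops π i m ∧ pSat lab ops ρ m j
  | .union π ρ, i, j => pSat lab ops π i j ∨ pSat lab ops ρ i j
  | .star π, i, j => Relation.ReflTransGen (fun a b => pSat lab ops π a b) i j
end

/-- LCPDL sentences: boolean combinations of `E φ`. -/
inductive Sent (A : Type) : Type where
  | ex : NF A → Sent A
  | or : Sent A → Sent A → Sent A
  | not : Sent A → Sent A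

/-- Satisfaction of an LCPDL sentence on the 2-NW `⟨lab, Nest1 ops, Nest2 ops⟩`. -/
def sSat {S A : Type} (lab : List A) (ops : List (Op S)) : Sent A → Prop
  | .ex φ => ∃ i, i < lab.length ∧ nSat lab ops φ i
  | .or Φ Ψ => sSat lab ops Φ ∨ sSat lab ops Ψ
  | .not Φ => ¬ sSat lab ops Φ

/-- Conjunction of node formulas. -/
def nfand {A : Type} (φ ψ : NF A) : NF A := .not (.or (.not φ) (.not ψ))
/-- Implication of node formulas. -/
def nfimp {A : Type} (φ ψ : NF A) : NF A := .or (.not φ) ψ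
/-- `π⁺ = π · π*`. -/
def pplus {A : Type} (π : PF A) : PF A := .comp π (.star π)
/-- `A φ = ¬ E ¬ φ`. -/
def sforall {A : Type} (φ : NF A) : Sent A := .not (.ex (.not φ))
/-- `ispush1 = ⟨↷1⟩true`. -/
def ispush1 {A : Type} : NF A := .dia .up1 .top
/-- `ispop1 = ⟨↶1⟩true`. -/
def ispop1 {A : Type} : NF A := .dia .dn1 .top
/-- `ispush2 = ⟨↷2⟩true`. -/
def ispush2 {A : Type} : NF A := .dia .up2 .top
/-- `ispop2 = ⟨↶2⟩true`. -/
def ispop2 {A : Type} : NF A := .dia .dn2 .top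

/-- `empty1 = ⟨↶1⟩ ¬⟨←⟩ true`: the `↑1` matching the current `↓1` is the first event,
so the top order-1 stack is empty after the current `↓1`. -/
def empty1 {A : Type} : NF A := .dia .dn1 (.not (.dia .bwd .top))

/-- `grid₁ = E (ispush1 ∧ ¬⟨←⟩true)`: the first event is a `↑1`. -/
def grid1 {A : Type} : Sent A := .ex (nfand ispush1 (.not (.dia .bwd .top)))

/-- `grid₂ = A (ispush1 ⟹ ⟨→·{ispush2}?·(→·{ispop1}?)⁺·{empty1}?·→·{ispop2}?⟩ true)`. -/
def grid2 {A : Type} : Sent A :=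
  sforall (nfimp ispush1 (.dia
    (.comp .fwd (.comp (.test ispush2)
      (.comp (pplus (.comp .fwd (.test ispop1)))
        (.comp (.test empty1) (.comp .fwd (.test ispop2)))))) .top))

/-- `grid₃ = A (ispop2 ⟹ ¬⟨→⟩true ∨ ⟨→·↷1⟩true)`. -/
def grid3 {A : Type} : Sent A :=
  sforall (nfimp ispop2 (.or (.not (.dia .fwd .top)) (.dia (.comp .fwd .up1) .top)))

def stk {S : Type} (ops : List (Op S)) (n : ℕ) : Option (Stk2 S) :=
  runFrom 0 (initStk S) (ops.take n)

theorem runFrom_append {S : Type} (l1 l2 : List (Op S)) : ∀ (p : ℕ) (W : Stk2 S),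
    runFrom p W (l1 ++ l2) = (runFrom p W l1).bind fun W' => runFrom (p + l1.length) W' l2 := by
  induction l1 with
  | nil => intro p W; simp [runFrom]
  | cons a l ih =>
    intro p W
    simp only [List.cons_append, runFrom]
    cases h : step p a W with
    | none => simp
    | some W' =>
      have e : p + 1 + l.length = p + (l.length + 1) := by omega
      simp [ih, e]

theorem stk_step {S : Type} {ops : List (Op S)} {n : ℕ} {W : Stk2 S} {op : Op S}
    (h : stk ops n = some W) (ho : ops[n]? = some op) : stk ops (n + 1) = step n op W := by
  have hl : n < ops.length := (List.getElem?_eq_some_iff.1 ho).1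
  unfold stk at *
  rw [List.take_add_one, ho, runFrom_append, h]
  simp [runFrom, Nat.min_eq_left hl.le]

theorem stkAt_eq {S : Type} (ops : List (Op S)) (j : ℕ) : stkAt ops ((j : ℤ) - 1) = stk ops j := by
  simp [stkAt, stk]

theorem stk_some {S : Type} {ops : List (Op S)} (hv : Valid ops) (n : ℕ) :
    ∃ W, stk ops n = some W := by
  have h := hv.2
  rw [← List.take_append_drop n ops, runFrom_append] at h
  unfold stk
  cases h' : runFrom 0 (initStk S) (ops.take n) with
  | none => simp [h'] at h
  | some W => exact ⟨W, rfl⟩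

/-- annotation invariant -/
theorem ann_inv {S : Type} {ops : List (Op S)} (hv : Valid ops) (n : ℕ) : n ≤ ops.length →
    ∀ W, stk ops n = some W → ∀ t ∈ W,
      (∀ m : ℕ, t.1 = (m : ℤ) → ops[m]? = some Op.push2) ∧
      (∀ x ∈ t.2, ∀ m : ℕ, x.2.2 = (m : ℤ) → ∃ s, ops[m]? = some (Op.push1 s)) := by
  induction n with
  | zero =>
    intro _ W h t ht
    simp [stk, runFrom, initStk] at h
    subst h
    simp at ht
    subst ht
    simp
  | succ n ih =>
    intro hn W h
    obtain ⟨V, hV⟩ := stk_some hv n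
    have ho : ops[n]? = some ops[n] := by simp
    rw [stk_step hV ho] at h
    have IH := ih (by omega) V hV
    generalize ops[n] = op at ho h
    unfold step at h
    split at h
    · simp only [Option.some.injEq] at h
      subst h
      simp only [List.forall_mem_cons] at IH ⊢
      refine ⟨⟨?_, IH.1.2⟩, IH⟩
      intro m hm
      have : n = m := by simpa using hm
      subst this; exact ho
    · simp only [Option.some.injEq] at h
      subst h
      exact fun t ht => IH t (List.mem_cons_of_mem _ ht)
    · simp only [Option.some.injEq] at h
      subst h
      simp only [List.forall_mem_cons] at IH ⊢
      refine ⟨⟨IH.1.1, ?_, IH.1.2⟩, IH.2⟩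
      intro m hm
      have : n = m := by simpa using hm
      subst this; exact ⟨_, ho⟩
    · simp only [Option.some.injEq] at h
      subst h
      simp only [List.forall_mem_cons] at IH ⊢
      exact ⟨⟨IH.1.1, IH.1.2.2⟩, IH.2⟩
    · split_ifs at h
      simp only [Option.some.injEq] at h
      subst h
      exact fun t ht => IH t (List.mem_of_mem_drop ht)
    · simp at h

theorem nest1_push {S : Type} {ops : List (Op S)} (hv : Valid ops) {i j : ℕ}
    (h : Nest1 ops i j) : ∃ s, ops[i]? = some (Op.push1 s) := by
  obtain ⟨hj, hi⟩ := h
  have hl : j < ops.length := (List.getElem?_eq_some_iff.1 hj).1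
  unfold push1At at hi
  rw [stkAt_eq] at hi
  split at hi
  · rename_i h
    exact ((ann_inv hv j hl.le _ h) _ List.mem_cons_self).2 _ List.mem_cons_self i hi.symm
  · omega

theorem nest2_push {S : Type} {ops : List (Op S)} (hv : Valid ops) (hcf : Op.collapse ∉ ops)
    {i j : ℕ} (h : Nest2 ops i j) : ops[i]? = some Op.push2 ∧ ops[j]? = some Op.pop2 := by
  rcases h with ⟨hj, hi⟩ | ⟨hj, _⟩
  · refine ⟨?_, hj⟩
    have hl : j < ops.length := (List.getElem?_eq_some_iff.1 hj).1
    unfold Push2At at hi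
    rw [stkAt_eq] at hi
    split at hi
    · rename_i h
      exact ((ann_inv hv j hl.le _ h) _ List.mem_cons_self).1 i hi.symm
    · omega
  · exact absurd (List.mem_of_getElem? hj) hcf

theorem pops {S : Type} {ops : List (Op S)} {n : ℕ} {a : ℤ} {v : Stk1 S} {r : Stk2 S}
    (h : stk ops n = some ((a, v) :: r)) (d : ℕ) (hd : d ≤ v.length)
    (hp : ∀ e, e < d → ops[n + e]? = some Op.pop1) :
    stk ops (n + d) = some ((a, v.drop d) :: r) := by
  induction d with
  | zero => simpa using h
  | succ d ih =>
    have := ih (by omega) (fun e he => hp e (by omega))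
    rw [← Nat.add_assoc, stk_step this (hp d (by omega)), List.drop_eq_getElem_cons (by omega)]
    rfl

theorem pops_le {S : Type} {ops : List (Op S)} (hv : Valid ops) {n : ℕ} {a : ℤ} {v : Stk1 S}
    {r : Stk2 S} (h : stk ops n = some ((a, v) :: r)) (d : ℕ)
    (hp : ∀ e, e < d → ops[n + e]? = some Op.pop1) : d ≤ v.length := by
  by_contra hc
  have h1 := pops h v.length le_rfl (fun e he => hp e (by omega))
  have h2 := stk_step h1 (hp _ (by omega))
  obtain ⟨W, hW⟩ := stk_some hv (n + v.length + 1)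
  rw [hW] at h2
  simp [step] at h2

def Good {S : Type} (u : Stk1 S) (i k : ℕ) : Prop :=
  u.length = i ∧ (k = 0 ↔ i = 0) ∧
    ∀ d (h : d < u.length), ∃ m : ℕ, u[d].2.2 = (m : ℤ) ∧ (m = 0 ↔ d + 1 = i)

theorem Good.cons {S : Type} {u : Stk1 S} {i k : ℕ} (h : Good u i k) (s : S) (c k' : ℕ)
    (hk : k' ≠ 0) : Good ((s, c, (k : ℤ)) :: u) (i + 1) k' := by
  obtain ⟨h1, h2, h3⟩ := h
  refine ⟨by simp [h1], by simp [hk], ?_⟩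
  intro d hd
  cases d with
  | zero => exact ⟨k, by simp, by omega⟩
  | succ d =>
    obtain ⟨m, hm, hm'⟩ := h3 d (by simpa using hd)
    exact ⟨m, by simpa using hm, by omega⟩

def block {S : Type} (i : ℕ) (s : S) : List (Op S) :=
  Op.push1 s :: Op.push2 :: (List.replicate (i + 1) Op.pop1 ++ [Op.pop2])

inductive IsGrid {S : Type} : ℕ → List (Op S) → Prop where
  | zero : IsGrid 0 []
  | succ (i : ℕ) (l : List (Op S)) (s : S) : IsGrid i l → IsGrid (i + 1) (l ++ block i s)

theorem isGrid_iff {S : Type} (s0 : S) (N : ℕ) : ∀ l : List (Op S), IsGrid N l ↔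
    ∃ f : ℕ → S, l = (List.range N).flatMap (fun i => block i (f i)) := by
  induction N with
  | zero =>
    intro l
    constructor
    · intro h; cases h; exact ⟨fun _ => s0, rfl⟩
    · rintro ⟨f, rfl⟩; exact IsGrid.zero
  | succ N ih =>
    intro l
    constructor
    · intro h
      cases h with
      | succ i l s h =>
        obtain ⟨f, rfl⟩ := (ih _).1 h
        refine ⟨Function.update f N s, ?_⟩
        simp only [List.range_succ, List.flatMap_append, List.flatMap_cons, List.flatMap_nil,
          List.append_nil, Function.update_self]
        congr 1
        apply List.flatMap_congr
        intro x hx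
        have : x ≠ N := by have := List.mem_range.1 hx; omega
        simp [this]
    · rintro ⟨f, rfl⟩
      simp only [List.range_succ, List.flatMap_append, List.flatMap_cons, List.flatMap_nil,
          List.append_nil]
      exact IsGrid.succ _ _ _ ((ih _).2 ⟨f, rfl⟩)

structure Ctx {S : Type} (ops : List (Op S)) (k i : ℕ) (u : Stk1 S) (s : S) : Prop where
  hs : stk ops k = some [(-1, u)]
  hg : Good u i k
  h0 : ops[k]? = some (Op.push1 s)
  h1 : ops[k + 1]? = some Op.push2
  h2 : ∀ d, d < i + 1 → ops[k + 2 + d]? = some Op.pop1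
  h3 : ops[k + 2 + (i + 1)]? = some Op.pop2

theorem stk2_of {S : Type} {ops : List (Op S)} {k : ℕ} {u : Stk1 S} {s : S}
    (hs : stk ops k = some [(-1, u)]) (h0 : ops[k]? = some (Op.push1 s))
    (h1 : ops[k + 1]? = some Op.push2) :
    stk ops (k + 2) = some [(((k + 1 : ℕ) : ℤ), (s, 0, (k : ℤ)) :: u),
      (-1, (s, 0, (k : ℤ)) :: u)] := by
  rw [stk_step (W := [(-1, (s, 0, (k : ℤ)) :: u)]) (n := k + 1) _ h1]
  · rfl
  · rw [stk_step hs h0]; rfl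

namespace Ctx
variable {S : Type} {ops : List (Op S)} {k i : ℕ} {u : Stk1 S} {s : S}

theorem mid (c : Ctx ops k i u s) (d : ℕ) (hd : d ≤ i + 1) :
    stk ops (k + 2 + d) = some [(((k + 1 : ℕ) : ℤ), ((s, 0, (k : ℤ)) :: u).drop d),
      (-1, (s, 0, (k : ℤ)) :: u)] :=
  pops (stk2_of c.hs c.h0 c.h1) d (by simp [c.hg.1]; omega) (fun e he => c.h2 e (by omega))

theorem good' (c : Ctx ops k i u s) : Good ((s, 0, (k : ℤ)) :: u) (i + 1) (k + 2 + (i + 1) + 1) :=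
  c.hg.cons s 0 _ (by omega)

theorem fin (c : Ctx ops k i u s) :
    stk ops (k + 2 + (i + 1) + 1) = some [(-1, (s, 0, (k : ℤ)) :: u)] := by
  rw [stk_step (c.mid (i + 1) le_rfl) c.h3]; rfl

theorem nest1 (c : Ctx ops k i u s) (d : ℕ) (hd : d < i + 1) :
    ∃ m, Nest1 ops m (k + 2 + d) ∧ (m = 0 ↔ d = i) := by
  obtain ⟨m, hm, hm'⟩ := c.good'.2.2 d (by have := c.good'.1; omega)
  refine ⟨m, ⟨c.h2 d hd, ?_⟩, by omega⟩
  unfold push1At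
  rw [stkAt_eq, c.mid d (by omega), List.drop_eq_getElem_cons (by have := c.good'.1; omega), ← hm]

theorem nest1_first (c : Ctx ops k i u s) : Nest1 ops k (k + 2) := by
  refine ⟨c.h2 0 (by omega), ?_⟩
  unfold push1At
  rw [stkAt_eq, c.mid 0 (by omega)]
  rfl

theorem nest2 (c : Ctx ops k i u s) : Nest2 ops (k + 1) (k + 2 + (i + 1)) := by
  refine Or.inl ⟨c.h3, ?_⟩
  unfold Push2At
  rw [stkAt_eq, c.mid (i + 1) le_rfl]

end Ctx

theorem block_get {S : Type} (i : ℕ) (s : S) (pre suf : List (Op S)) (k : ℕ)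
    (hk : pre.length = k) :
    (pre ++ block i s ++ suf)[k]? = some (Op.push1 s) ∧
    (pre ++ block i s ++ suf)[k + 1]? = some Op.push2 ∧
    (∀ d, d < i + 1 → (pre ++ block i s ++ suf)[k + 2 + d]? = some Op.pop1) ∧
    (pre ++ block i s ++ suf)[k + 2 + (i + 1)]? = some Op.pop2 := by
  subst hk
  have key : ∀ j, (pre ++ block i s ++ suf)[pre.length + j]? = (block i s ++ suf)[j]? := by
    intro j
    rw [List.append_assoc, List.getElem?_append_right (by omega)]
    simp
  refine ⟨?_, ?_, ?_, ?_⟩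
  · have := key 0; rw [Nat.add_zero] at this; rw [this]; simp [block]
  · rw [key]; simp [block]
  · intro d hd
    rw [Nat.add_assoc, key, Nat.add_comm 2 d]
    simp [block, List.getElem?_append, hd]
  · rw [Nat.add_assoc, key, Nat.add_comm 2 (i + 1)]
    simp [block, List.getElem?_append]

theorem block_length {S : Type} (i : ℕ) (s : S) : (block i s).length = 2 + (i + 1) + 1 := by
  simp [block]; omega

theorem isGrid_stk {S : Type} {i : ℕ} {pre : List (Op S)} (h : IsGrid i pre) :
    ∃ u, runFrom 0 (initStk S) pre = some [(-1, u)] ∧ Good u i pre.length := by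
  induction h with
  | zero => exact ⟨[], rfl, by simp [Good]⟩
  | succ i l s hl ih =>
    obtain ⟨u, hu, hg⟩ := ih
    obtain ⟨g0, g1, g2, g3⟩ := block_get i s l [] _ rfl
    have c : Ctx (l ++ block i s ++ []) l.length i u s :=
      ⟨by simpa [stk] using hu, hg, g0, g1, g2, g3⟩
    refine ⟨(s, 0, (l.length : ℤ)) :: u, ?_, ?_⟩
    · have := c.fin
      unfold stk at this
      rw [List.take_of_length_le (by simp [block_length]; omega), List.append_nil] at this
      exact this
    · rw [List.length_append, block_length]
      exact hg.cons s 0 _ (by omega)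

theorem isGrid_ctx {S : Type} {i : ℕ} {pre : List (Op S)} (h : IsGrid i pre) (s : S)
    (suf : List (Op S)) : ∃ u, Ctx (pre ++ block i s ++ suf) pre.length i u s := by
  obtain ⟨u, hu, hg⟩ := isGrid_stk h
  obtain ⟨g0, g1, g2, g3⟩ := block_get i s pre suf _ rfl
  exact ⟨u, by simpa [stk] using hu, hg, g0, g1, g2, g3⟩

theorem isGrid_decomp {S : Type} {N : ℕ} {l : List (Op S)} (h : IsGrid N l) :
    ∀ q, q < l.length → ∃ i pre s suf, IsGrid i pre ∧ l = pre ++ block i s ++ suf ∧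
      pre.length ≤ q ∧ q < pre.length + (2 + (i + 1) + 1) ∧
      ((suf = [] ∧ N = i + 1) ∨ ∃ s' suf', suf = block (i + 1) s' ++ suf') := by
  induction h with
  | zero => intro q hq; simp at hq
  | succ i l s hl ih =>
    intro q hq
    rw [List.length_append, block_length] at hq
    by_cases hc : q < l.length
    · obtain ⟨j, pre, s1, suf, h1, rfl, h3, h4, h5⟩ := ih q hc
      refine ⟨j, pre, s1, suf ++ block i s, h1, by simp, h3, h4, Or.inr ?_⟩
      rcases h5 with ⟨rfl, rfl⟩ | ⟨s', suf', rfl⟩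
      · exact ⟨s, [], by simp⟩
      · exact ⟨s', suf' ++ block i s, by simp⟩
    · exact ⟨i, l, s, [], hl, by simp, by omega, by omega, Or.inl ⟨rfl, rfl⟩⟩

/-- Semantic content of the three formulas. -/
theorem grid1_iff {S A : Type} (ops : List (Op S)) (lab : List A) (hlen : lab.length = ops.length) :
    sSat lab ops grid1 ↔ ∃ j, Nest1 ops 0 j ∧ j < ops.length := by
  simp only [sSat, grid1, nfand, ispush1, nSat, pSat, hlen]
  constructor
  · rintro ⟨i, hi, -, h⟩
    have h1 : ∃ j, Nest1 ops i j ∧ j < ops.length := by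
      by_contra hc; exact h (Or.inl ⟨hi, hc⟩)
    cases i with
    | zero => exact h1
    | succ i =>
      exfalso
      apply h
      refine Or.inr ⟨hi, fun h' => h'.2 ⟨i, ⟨rfl, hi⟩, by omega⟩⟩
  · rintro ⟨j, hj, hl⟩
    refine ⟨0, by omega, by omega, ?_⟩
    rintro (⟨_, h⟩ | ⟨_, h⟩)
    · exact h ⟨j, hj, hl⟩
    · refine h ⟨by omega, ?_⟩
      rintro ⟨j, ⟨h, _⟩, _⟩
      omega

theorem forall_imp_iff {S A : Type} (ops : List (Op S)) (lab : List A) (φ ψ : NF A) :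
    sSat lab ops (sforall (nfimp φ ψ)) ↔
      ∀ i, i < lab.length → nSat lab ops φ i → nSat lab ops ψ i := by
  simp only [sSat, sforall, nfimp, nSat]
  push Not
  constructor
  · intro h i hi hφ
    rcases h i hi hi with h | h
    · exact absurd hφ h.2
    · exact h
  · intro h i hi _
    by_cases hφ : nSat lab ops φ i
    · exact Or.inr (h i hi hφ)
    · exact Or.inl ⟨hi, hφ⟩

theorem rtg_iff {S A : Type} (ops : List (Op S)) (lab : List A) (a b : ℕ) :
    Relation.ReflTransGen (fun a b => pSat lab ops (.comp .fwd (.test ispop1)) a b) a b ↔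
    ∃ d, b = a + d ∧ ∀ e, e < d → nSat lab ops ispop1 (a + e + 1) ∧ a + e + 1 < lab.length := by
  constructor
  · intro h
    induction h with
    | refl => exact ⟨0, rfl, by simp⟩
    | tail _ h ih =>
      obtain ⟨d, rfl, hd⟩ := ih
      simp only [pSat] at h
      obtain ⟨m, ⟨rfl, hl⟩, rfl, hp⟩ := h
      refine ⟨d + 1, rfl, ?_⟩
      intro e he
      rcases Nat.lt_succ_iff_lt_or_eq.1 he with h | rfl
      · exact hd e h
      · exact ⟨hp, hl⟩
  · rintro ⟨d, rfl, hd⟩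
    induction d with
    | zero => exact .refl
    | succ d ih =>
      refine (ih fun e he => hd e (by omega)).tail ?_
      simp only [pSat]
      exact ⟨_, ⟨rfl, (hd d (by omega)).2⟩, rfl, (hd d (by omega)).1⟩

theorem grid2_iff {S A : Type} (ops : List (Op S)) (lab : List A) (hlen : lab.length = ops.length) :
    sSat lab ops grid2 ↔ ∀ i j, i < ops.length → j < ops.length → Nest1 ops i j →
      ∃ d, i + 2 + d + 1 < ops.length ∧
        (∃ j, Nest2 ops (i + 1) j ∧ j < ops.length) ∧
        (∀ e, e ≤ d → ∃ m, Nest1 ops m (i + 2 + e) ∧ m < ops.length) ∧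
        Nest1 ops 0 (i + 2 + d) ∧ ∃ m, Nest2 ops m (i + 2 + d + 1) ∧ m < ops.length := by
  unfold grid2
  rw [forall_imp_iff]
  have hA : ∀ i, nSat lab ops ispush1 i ↔ ∃ j, Nest1 ops i j ∧ j < ops.length := by
    intro i; simp [ispush1, nSat, pSat, hlen]
  have hE : ∀ i, nSat lab ops empty1 i ↔ Nest1 ops 0 i ∧ 0 < ops.length := by
    intro i
    simp only [empty1, nSat, pSat, hlen]
    constructor
    · rintro ⟨j, hj, hl, h⟩
      cases j with
      | zero => exact ⟨hj, hl⟩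
      | succ j => exact absurd ⟨j, ⟨rfl, hl⟩, by omega⟩ h
    · rintro ⟨h, hl⟩
      refine ⟨0, h, hl, ?_⟩
      rintro ⟨j, ⟨h, _⟩, _⟩
      omega
  have hP : ∀ i, nSat lab ops ispop1 i ↔ ∃ j, Nest1 ops j i ∧ j < ops.length := by
    intro i; simp [ispop1, nSat, pSat, hlen]
  have hB : ∀ i, nSat lab ops (.dia
    (.comp .fwd (.comp (.test ispush2)
      (.comp (pplus (.comp .fwd (.test ispop1)))
        (.comp (.test empty1) (.comp .fwd (.test ispop2)))))) .top) i ↔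
      ∃ d, i + 2 + d + 1 < ops.length ∧
        (∃ j, Nest2 ops (i + 1) j ∧ j < ops.length) ∧
        (∀ e, e ≤ d → ∃ m, Nest1 ops m (i + 2 + e) ∧ m < ops.length) ∧
        Nest1 ops 0 (i + 2 + d) ∧ ∃ m, Nest2 ops m (i + 2 + d + 1) ∧ m < ops.length := by
    intro i
    rw [nSat]
    simp only [pplus]
    constructor
    · rintro ⟨z, hz, -⟩
      rw [pSat] at hz
      obtain ⟨a, ha, hz⟩ := hz
      rw [pSat] at ha
      obtain ⟨rfl, hal⟩ := ha
      rw [pSat] at hz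
      obtain ⟨a, ha, hz⟩ := hz
      rw [pSat] at ha
      obtain ⟨rfl, h2⟩ := ha
      rw [pSat] at hz
      obtain ⟨b, hb, hz⟩ := hz
      rw [pSat] at hb
      obtain ⟨a, ha, hb⟩ := hb
      rw [pSat, rtg_iff] at hb
      obtain ⟨d, rfl, hd⟩ := hb
      simp only [pSat] at ha
      obtain ⟨_, ⟨rfl, hl⟩, rfl, hp⟩ := ha
      simp only [pSat] at hz
      obtain ⟨_, ⟨rfl, he⟩, _, ⟨rfl, hl'⟩, rfl, hz⟩ := hz
      refine ⟨d, by rw [← hlen]; exact hl', ?_, ?_, ((hE _).1 he).1, ?_⟩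
      · simpa [ispush2, nSat, pSat, hlen] using h2
      · intro e he
        cases e with
        | zero => exact (hP _).1 hp
        | succ e => exact (hP _).1 (hd e (by omega)).1
      · simpa [ispop2, nSat, pSat, hlen] using hz
    · rintro ⟨d, hl, h2, h1, h0, h3⟩
      refine ⟨i + 2 + d + 1, ?_, by simp [nSat]; omega⟩
      rw [pSat]
      refine ⟨i + 1, by simp [pSat]; omega, ?_⟩
      rw [pSat]
      refine ⟨i + 1, ?_, ?_⟩
      · rw [pSat]
        exact ⟨rfl, by simpa [ispush2, nSat, pSat, hlen] using h2⟩
      rw [pSat]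
      refine ⟨i + 2 + d, ?_, ?_⟩
      · rw [pSat]
        refine ⟨i + 2, ?_, ?_⟩
        · simp only [pSat]
          exact ⟨_, ⟨rfl, by omega⟩, rfl, (hP _).2 (h1 0 (by omega))⟩
        · rw [pSat, rtg_iff]
          exact ⟨d, rfl, fun e he => ⟨(hP _).2 (h1 (e + 1) (by omega)), by omega⟩⟩
      · simp only [pSat]
        refine ⟨_, ⟨rfl, (hE _).2 ⟨h0, by omega⟩⟩, _, ⟨rfl, by omega⟩, rfl, ?_⟩
        simpa [ispop2, nSat, pSat, hlen] using h3
  simp only [hA, hB, hlen]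
  constructor
  · intro h i j hi hj hn
    exact h i hi ⟨j, hn, hj⟩
  · rintro h i hi ⟨j, hn, hj⟩
    exact h i j hi hj hn

theorem grid3_iff {S A : Type} (ops : List (Op S)) (lab : List A) (hlen : lab.length = ops.length) :
    sSat lab ops grid3 ↔ ∀ i j, i < ops.length → j < ops.length → Nest2 ops j i →
      ops.length ≤ i + 1 ∨ ∃ m, Nest1 ops (i + 1) m ∧ m < ops.length := by
  unfold grid3
  rw [forall_imp_iff]
  simp only [ispop2, nSat, pSat, hlen]
  constructor
  · intro h i j hi hj hn
    rcases h i hi ⟨j, hn, hj⟩ with ⟨-, h⟩ | ⟨j, ⟨_, ⟨rfl, _⟩, h⟩, hl⟩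
    · left
      by_contra hc
      exact h ⟨i + 1, ⟨rfl, by omega⟩, by omega⟩
    · exact Or.inr ⟨j, h, hl⟩
  · rintro h i hi ⟨j, hn, hj⟩
    rcases h i j hi hj hn with h | ⟨m, h, hl⟩
    · left
      refine ⟨hi, ?_⟩
      rintro ⟨_, ⟨rfl, _⟩, _⟩
      omega
    · by_cases hc : i + 1 < ops.length
      · exact Or.inr ⟨m, ⟨_, ⟨rfl, hc⟩, h⟩, hl⟩
      · left
        refine ⟨hi, ?_⟩
        rintro ⟨_, ⟨rfl, _⟩, _⟩
        omega

theorem take_block {S : Type} {ops : List (Op S)} {k i : ℕ} {u : Stk1 S} {s : S}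
    (c : Ctx ops k i u s) : ops.take (k + 2 + (i + 1) + 1) = ops.take k ++ block i s := by
  have hr : ∀ d, d ≤ i + 1 → ops.take (k + 2 + d) =
      ops.take k ++ Op.push1 s :: Op.push2 :: List.replicate d Op.pop1 := by
    intro d
    induction d with
    | zero =>
      intro _
      rw [Nat.add_zero, List.take_add_one, List.take_add_one, c.h0, c.h1]
      simp
    | succ d ih =>
      intro hd
      rw [← Nat.add_assoc, List.take_add_one, ih (by omega), c.h2 d (by omega),
        List.replicate_succ']
      simp
  rw [List.take_add_one, hr _ le_rfl, c.h3]
  simp [block]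

theorem forward {S : Type} {ops : List (Op S)} (hv : Valid ops) (hcf : Op.collapse ∉ ops)
    (g2 : ∀ i j, i < ops.length → j < ops.length → Nest1 ops i j →
      ∃ d, i + 2 + d + 1 < ops.length ∧
        (∃ j, Nest2 ops (i + 1) j ∧ j < ops.length) ∧
        (∀ e, e ≤ d → ∃ m, Nest1 ops m (i + 2 + e) ∧ m < ops.length) ∧
        Nest1 ops 0 (i + 2 + d) ∧ ∃ m, Nest2 ops m (i + 2 + d + 1) ∧ m < ops.length)
    (g3 : ∀ i j, i < ops.length → j < ops.length → Nest2 ops j i →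
      ops.length ≤ i + 1 ∨ ∃ m, Nest1 ops (i + 1) m ∧ m < ops.length) (n : ℕ) :
    ∀ k i u j, ops.length - k ≤ n → IsGrid i (ops.take k) → stk ops k = some [(-1, u)] →
      Good u i k → Nest1 ops k j → ∃ N, 1 ≤ N ∧ IsGrid N ops := by
  induction n with
  | zero =>
    intro k i u j hn _ _ _ hj
    obtain ⟨s, hs⟩ := nest1_push hv hj
    have := (List.getElem?_eq_some_iff.1 hs).1
    omega
  | succ n ih =>
    intro k i u j hn hG hs hg hj
    obtain ⟨s, h0⟩ := nest1_push hv hj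
    have hk := (List.getElem?_eq_some_iff.1 h0).1
    have hjl := (List.getElem?_eq_some_iff.1 hj.1).1
    obtain ⟨d, hl, ⟨j2, hj2, _⟩, hpop, hz, m, hm, hml⟩ := g2 k j hk hjl hj
    have h1 := (nest2_push hv hcf hj2).1
    have hp : ∀ e, e < d + 1 → ops[k + 2 + e]? = some Op.pop1 := by
      intro e he
      obtain ⟨_, h, _⟩ := hpop e (by omega)
      exact h.1
    have hst := stk2_of hs h0 h1
    have hle := pops_le hv hst (d + 1) hp
    have hd := pops hst d (by omega) (fun e he => hp e (by omega))
    have hgood := hg.cons s 0 1 one_ne_zero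
    have hdi : d = i := by
      obtain ⟨x, hx, hx'⟩ := hgood.2.2 d (by omega)
      have h := hz.2
      unfold push1At at h
      rw [stkAt_eq, hd, List.drop_eq_getElem_cons (by omega)] at h
      simp only at h
      rw [hx] at h
      omega
    subst hdi
    have c : Ctx ops k d u s := ⟨hs, hg, h0, h1, hp, (nest2_push hv hcf hm).2⟩
    have hG' := IsGrid.succ _ _ s hG
    rw [← take_block c] at hG'
    rcases g3 _ _ hl hml hm with h | ⟨j', hj', _⟩
    · rw [List.take_of_length_le (by omega)] at hG'
      exact ⟨_, by omega, hG'⟩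
    · exact ih _ _ _ j' (by omega) hG' c.fin c.good' hj'

theorem grid_characterisation {S A : Type} (ops : List (Op S)) (lab : List A)
    (hv : Valid ops) (hcf : Op.collapse ∉ ops) (hlen : lab.length = ops.length) :
    (sSat lab ops grid1 ∧ sSat lab ops grid2 ∧ sSat lab ops grid3) ↔
    ∃ N : ℕ, 1 ≤ N ∧ ∃ f : ℕ → S,
      ops = (List.range N).flatMap (fun i =>
        Op.push1 (f i) :: Op.push2 ::
          (List.replicate (i + 1) Op.pop1 ++ [Op.pop2])) := by
  rw [grid1_iff ops lab hlen, grid2_iff ops lab hlen, grid3_iff ops lab hlen]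
  constructor
  · rintro ⟨⟨j, hj, -⟩, g2, g3⟩
    obtain ⟨s, -⟩ := nest1_push hv hj
    obtain ⟨N, hN, hG⟩ := forward hv hcf g2 g3 ops.length 0 0 [] j (by omega) IsGrid.zero rfl
      (by simp [Good]) hj
    exact ⟨N, hN, (isGrid_iff s N ops).1 hG⟩
  · rintro ⟨N, hN, f, hf⟩
    have hG : IsGrid N ops := (isGrid_iff (f 0) N ops).2 ⟨f, hf⟩
    clear hf
    have hlt : ∀ {q : ℕ} {o : Op S}, ops[q]? = some o → q < ops.length :=
      fun h => (List.getElem?_eq_some_iff.1 h).1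
    have dec : ∀ q, q < ops.length → ∃ i k u s, Ctx ops k i u s ∧ k ≤ q ∧
        q < k + (2 + (i + 1) + 1) ∧ (i = 0 → k = 0) ∧
        (ops.length = k + (2 + (i + 1) + 1) ∨
          ∃ u' s', Ctx ops (k + (2 + (i + 1) + 1)) (i + 1) u' s') := by
      intro q hq
      obtain ⟨i, pre, s, suf, h1, h2, h3, h4, h5⟩ := isGrid_decomp hG q hq
      obtain ⟨u, c⟩ := isGrid_ctx h1 s suf
      rw [← h2] at c
      refine ⟨i, _, u, s, c, h3, h4, c.hg.2.1.2, ?_⟩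
      rcases h5 with ⟨rfl, rfl⟩ | ⟨s', suf', rfl⟩
      · left; rw [h2]; simp [block_length]
      · right
        obtain ⟨u', c'⟩ := isGrid_ctx (h1.succ _ _ s) s' suf'
        rw [List.append_assoc (pre ++ block i s), ← h2] at c'
        rw [List.length_append, block_length] at c'
        exact ⟨u', s', c'⟩
    refine ⟨?_, ?_, ?_⟩
    · obtain ⟨i, k, u, s, c, h3, -⟩ := dec 0 (List.length_pos_iff.2 hv.1)
      obtain rfl : k = 0 := by omega
      exact ⟨_, c.nest1_first, hlt c.nest1_first.1⟩
    · intro q j hq hj hn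
      obtain ⟨s', hs'⟩ := nest1_push hv hn
      obtain ⟨i, k, u, s, c, h3, h4, -⟩ := dec q hq
      have hqk : q = k := by
        by_contra hne
        rcases (by omega : q = k + 1 ∨ (q - (k + 2) < i + 1 ∧ q = k + 2 + (q - (k + 2))) ∨ q = k + 2 + (i + 1))
          with rfl | ⟨hd, he⟩ | rfl
        · simp [c.h1] at hs'
        · rw [he, c.h2 _ hd] at hs'
          simp at hs'
        · simp [c.h3] at hs'
      subst hqk
      have hl := hlt c.h3
      refine ⟨i, hl, ⟨_, c.nest2, hl⟩, ?_, ?_, ⟨_, c.nest2, by omega⟩⟩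
      · intro e he
        obtain ⟨m, hm, -⟩ := c.nest1 e (by omega)
        obtain ⟨_, h⟩ := nest1_push hv hm
        exact ⟨m, hm, hlt h⟩
      · obtain ⟨m, hm, hm'⟩ := c.nest1 i (by omega)
        obtain rfl := hm'.2 rfl
        exact hm
    · intro q j hq hj hn
      have hs' := (nest2_push hv hcf hn).2
      obtain ⟨i, k, u, s, c, h3, h4, -, h5⟩ := dec q hq
      have hqk : q = k + 2 + (i + 1) := by
        by_contra hne
        rcases (by omega : q = k ∨ q = k + 1 ∨ (q - (k + 2) < i + 1 ∧ q = k + 2 + (q - (k + 2))))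
          with rfl | rfl | ⟨hd, he⟩
        · simp [c.h0] at hs'
        · simp [c.h1] at hs'
        · rw [he, c.h2 _ hd] at hs'
          simp at hs'
      subst hqk
      rcases h5 with h5 | ⟨u', s', c'⟩
      · left; omega
      · right
        have := c'.nest1_first
        rw [show k + (2 + (i + 1) + 1) = k + 2 + (i + 1) + 1 by omega] at this
        exact ⟨_, this, hlt this.1⟩
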